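/- Let 𝐗, 𝐘, Z₀ be pairwise disjoint node sets in a DAG D with 𝐗 and 𝐘 nonempty, such that Z₀ satisfies the adjustment criterion relative to (𝐗,𝐘) in D. Let Z = Z₀ ∪ (An(𝐗 ∪ 𝐘, D) \ (De(𝐗,D) ∪ 𝐘)), and set Z_D = Z ∩ De(𝐗,D), Z_N = Z \ De(𝐗,D), 𝐘_D = 𝐘 ∩ De(𝐗,D), 𝐘_N = 𝐘 \ De(𝐗,D). Then: (i) (𝐗 ∪ 𝐘_N ∪ Z) ∩ forb(𝐗,𝐘,D) = ∅; (ii) every non-causal path in D from a node A ∈ 𝐗 ∪ 𝐘_N ∪ Z to a node of 𝐘_D is blocked by (𝐗 ∪ 𝐘_N ∪ Z_N) \ {A}; and (iii) 𝐘_D and Z_D are d-separated given 𝐘_N ∪ 𝐗 ∪ Z_N in D (where 𝐘_N may be empty). -/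

import Mathlib

attribute [local instance] Classical.propDecidable

/-- A finite directed acyclic graph on vertex type `V`. -/
structure DAG (V : Type) [Fintype V] [DecidableEq V] where
  /-- the edge relation: `Edge a b` means there is a directed edge `a → b` -/
  Edge : V → V → Prop
  /-- there are no directed cycles -/
  acyclic : ∀ v, ¬ Relation.TransGen Edge v v

namespace DAG

variable {V : Type} [Fintype V] [DecidableEq V]

/-- two nodes are adjacent if they are joined by an edge in either direction -/
def Adj (D : DAG V) (a b : V) : Prop := D.Edge a b ∨ D.Edge b a

/-- `p` is a path from `x` to `y`: a list of distinct nodes, consecutive ones adjacent,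
starting at `x` and ending at `y`. -/
def IsPathFrom (D : DAG V) (p : List V) (x y : V) : Prop :=
  p.Nodup ∧ p.Chain' D.Adj ∧ p.head? = some x ∧ p.getLast? = some y

/-- a causal (directed) path: all edges point forward -/
def IsCausal (D : DAG V) (p : List V) : Prop := p.Chain' D.Edge

/-- descendants of a set of nodes (every node is its own descendant) -/
def Desc (D : DAG V) (S : Set V) : Set V :=
  {v | ∃ w ∈ S, Relation.ReflTransGen D.Edge w v}

/-- ancestors of a set of nodes (every node is its own ancestor) -/
def Anc (D : DAG V) (S : Set V) : Set V :=
  {v | ∃ w ∈ S, Relation.ReflTransGen D.Edge v w}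

/-- `w` is a collider on the path `p`: both edges of `p` at `w` point into `w` -/
def IsColliderOn (D : DAG V) (p : List V) (w : V) : Prop :=
  ∃ a b, [a, w, b] <:+: p ∧ D.Edge a w ∧ D.Edge b w

/-- `w` is a non-collider on `p`: a non-endpoint node of `p` that is not a collider on `p` -/
def IsNonColliderOn (D : DAG V) (p : List V) (w : V) : Prop :=
  (∃ a b, [a, w, b] <:+: p) ∧ ¬ D.IsColliderOn p w

/-- `Z` blocks the path `p`: some non-collider on `p` is in `Z`, or some collider on `p`
has no descendant in `Z`.  Otherwise `p` is d-connecting given `Z`. -/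
def Blocks (D : DAG V) (Z : Set V) (p : List V) : Prop :=
  (∃ w, D.IsNonColliderOn p w ∧ w ∈ Z) ∨
  (∃ w, D.IsColliderOn p w ∧ D.Desc {w} ∩ Z = ∅)

/-- `p` is a proper causal path from `X` to `Y` -/
def ProperCausalPath (D : DAG V) (X Y : Set V) (p : List V) : Prop :=
  (∃ x ∈ X, ∃ y ∈ Y, D.IsPathFrom p x y) ∧ (∀ v ∈ p.tail, v ∉ X) ∧ D.IsCausal p

/-- `p` is a proper non-causal path from `X` to `Y` -/
def ProperNonCausalPath (D : DAG V) (X Y : Set V) (p : List V) : Prop :=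
  (∃ x ∈ X, ∃ y ∈ Y, D.IsPathFrom p x y) ∧ (∀ v ∈ p.tail, v ∉ X) ∧ ¬ D.IsCausal p

/-- the forbidden set: all descendants of nodes `W ∉ X` lying on a proper causal path
from `X` to `Y` -/
def Forb (D : DAG V) (X Y : Set V) : Set V :=
  {v | ∃ p w, D.ProperCausalPath X Y p ∧ w ∈ p ∧ w ∉ X ∧
    Relation.ReflTransGen D.Edge w v}

/-- the adjustment criterion of Shpitser et al. / van der Zander et al. -/
def SatisfiesAC (D : DAG V) (X Y Z : Set V) : Prop :=
  Z ∩ D.Forb X Y = ∅ ∧ ∀ p, D.ProperNonCausalPath X Y p → D.Blocks Z p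

/-- the constructive set `Adjust(X,Y,D)` -/
def AdjustSet (D : DAG V) (X Y : Set V) : Set V :=
  D.Anc (X ∪ Y) \ (X ∪ Y ∪ D.Forb X Y)

/-- `Z` d-separates `X` and `Y` in `D`: `Z` blocks every path from `X` to `Y` -/
def DSep (D : DAG V) (X Y Z : Set V) : Prop :=
  ∀ x ∈ X, ∀ y ∈ Y, ∀ p, D.IsPathFrom p x y → D.Blocks Z p

/-- `p` is a back-door path from `x`: its first edge points into `x` -/
def IsBackdoorFrom (D : DAG V) (p : List V) (x : V) : Prop :=
  ∃ b rest, p = x :: b :: rest ∧ D.Edge b x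

/-- Pearl's back-door criterion -/
def BackdoorCriterion (D : DAG V) (X Y Z : Set V) : Prop :=
  Z ∩ D.Desc X = ∅ ∧
  ∀ x ∈ X, ∀ y ∈ Y, ∀ p, D.IsPathFrom p x y → D.IsBackdoorFrom p x → D.Blocks Z p

/-- the generalized back-door criterion of Maathuis and Colombo -/
def GenBackdoorCriterion (D : DAG V) (X Y Z : Set V) : Prop :=
  Z ∩ D.Desc X = ∅ ∧
  ∀ x ∈ X, ∀ y ∈ Y, ∀ p, D.IsPathFrom p x y → D.IsBackdoorFrom p x →
    D.Blocks ((Z ∪ X) \ {x}) p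

end DAG


namespace DAG

variable {V : Type} [Fintype V] [DecidableEq V]

open Relation

/-- some directed path from `v` to a node of `Y` has no node in `X` -/
def ReachesAvoiding (D : DAG V) (X Y : Set V) (v : V) : Prop :=
  ∃ r, D.IsCausal (v :: r) ∧ (∃ y ∈ Y, (v :: r).getLast? = some y) ∧ ∀ t ∈ v :: r, t ∉ X

section

variable {D : DAG V} {X Y S : Set V}

lemma not_edge_of_edge {a b : V} (h : D.Edge a b) : ¬ D.Edge b a := fun h' =>
  D.acyclic a (.tail (.single h) h')

lemma mem_desc_of_reaches {v w : V} (hv : v ∈ D.Desc X) (h : ReflTransGen D.Edge v w) :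
    w ∈ D.Desc X := by
  obtain ⟨x, hx, hxv⟩ := hv
  exact ⟨x, hx, hxv.trans h⟩

lemma mem_forb_of_reaches {v w : V} (hv : v ∈ D.Forb X Y) (h : ReflTransGen D.Edge v w) :
    w ∈ D.Forb X Y := by
  obtain ⟨p, u, hp, hu, huX, huv⟩ := hv
  exact ⟨p, u, hp, hu, huX, huv.trans h⟩

lemma IsCausal.nodup {p : List V} (h : D.IsCausal p) : p.Nodup := by
  have h1 : List.IsChain (TransGen D.Edge) p := List.IsChain.imp (fun _ _ => .single) h
  refine (List.isChain_iff_pairwise.1 h1).imp ?_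
  rintro a b hab rfl
  exact D.acyclic a hab

lemma IsCausal.isChain_adj {p : List V} (h : D.IsCausal p) : p.IsChain D.Adj :=
  List.IsChain.imp (fun _ _ => Or.inl) h

lemma IsCausal.reaches {v : V} {r : List V} (h : D.IsCausal (v :: r)) :
    ∀ t ∈ v :: r, ReflTransGen D.Edge v t := by
  induction r generalizing v with
  | nil => simp only [List.mem_singleton]; rintro t rfl; exact .refl
  | cons b r ih =>
    obtain ⟨h1, h2⟩ := List.isChain_cons_cons.1 h
    intro t ht
    rcases List.mem_cons.1 ht with rfl | ht
    · exact .refl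
    · exact .head h1 (ih h2 t ht)

lemma IsCausal.not_isColliderOn {p : List V} (h : D.IsCausal p) (w : V) :
    ¬ D.IsColliderOn p w := by
  rintro ⟨a, b, ⟨l, r, rfl⟩, -, hb⟩
  have h1 : List.IsChain D.Edge [a, w, b] :=
    (List.isChain_append.1 (List.isChain_append.1 h).1).2.1
  exact not_edge_of_edge hb (List.isChain_cons_cons.1 (List.isChain_cons_cons.1 h1).2).1

lemma not_isColliderOn_cons {u v : V} {r : List V} (huv : D.Edge v u)
    (h : ∀ w, ¬ D.IsColliderOn (v :: r) w) (w : V) : ¬ D.IsColliderOn (u :: v :: r) w := by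
  rintro ⟨a, b, hi, ha, hb⟩
  rcases List.infix_cons_iff.1 hi with hp | hi
  · simp only [List.cons_prefix_cons] at hp
    obtain ⟨rfl, rfl, -⟩ := hp
    exact not_edge_of_edge huv ha
  · exact h w ⟨a, b, hi, ha, hb⟩

lemma ReachesAvoiding.of_append {s r : List V} {v : V} (hc : D.IsCausal (s ++ v :: r))
    (hl : ∃ y ∈ Y, (s ++ v :: r).getLast? = some y) (hX : ∀ t ∈ v :: r, t ∉ X) :
    D.ReachesAvoiding X Y v := by
  refine ⟨r, (List.isChain_append.1 hc).2.1, ?_, hX⟩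
  simpa [List.getLast?_append] using hl

lemma ReachesAvoiding.notMem {v : V} (h : D.ReachesAvoiding X Y v) : v ∉ X := by
  obtain ⟨r, -, -, h⟩ := h
  exact h v (by simp)

lemma ReachesAvoiding.cons {u v : V} (h : D.ReachesAvoiding X Y v) (huv : D.Edge u v)
    (hu : u ∉ X) : D.ReachesAvoiding X Y u := by
  obtain ⟨r, hc, hl, hX⟩ := h
  refine ⟨v :: r, List.isChain_cons_cons.2 ⟨huv, hc⟩, by simpa using hl, ?_⟩
  simpa [hu] using hX

lemma ReachesAvoiding.reaches {v : V} (h : D.ReachesAvoiding X Y v) :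
    ∃ y ∈ Y, ReflTransGen D.Edge v y := by
  obtain ⟨r, hc, ⟨y, hy, hl⟩, -⟩ := h
  exact ⟨y, hy, hc.reaches y (List.mem_of_getLast? hl)⟩

lemma mem_forb_of_reachesAvoiding {v : V} (h : D.ReachesAvoiding X Y v) (hv : v ∈ D.Desc X) :
    v ∈ D.Forb X Y := by
  obtain ⟨x, hx, hxv⟩ := hv
  have key : ∀ u, ReflTransGen D.Edge u v →
      (∃ p, D.ProperCausalPath X Y p ∧ v ∈ p) ∨
      ∃ r, D.IsCausal (u :: r) ∧ (∃ y ∈ Y, (u :: r).getLast? = some y) ∧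
        (∀ t ∈ u :: r, t ∉ X) ∧ v ∈ u :: r := by
    intro u hu
    induction hu using ReflTransGen.head_induction_on with
    | refl =>
      obtain ⟨r, h1, h2, h3⟩ := h
      exact .inr ⟨r, h1, h2, h3, by simp⟩
    | @head u w huw _ ih =>
      rcases ih with ih | ⟨r, h1, h2, h3, h4⟩
      · exact .inl ih
      have hc : D.IsCausal (u :: w :: r) := List.isChain_cons_cons.2 ⟨huw, h1⟩
      by_cases hu : u ∈ X
      · obtain ⟨y, hy, hl⟩ := h2
        exact .inl ⟨u :: w :: r, ⟨⟨u, hu, y, hy, hc.nodup, hc.isChain_adj, rfl, by simpa using hl⟩,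
          by simpa using h3, hc⟩, List.mem_cons_of_mem _ h4⟩
      · exact .inr ⟨w :: r, hc, by simpa using h2, by simpa [hu] using h3,
          List.mem_cons_of_mem _ h4⟩
  rcases key x hxv with ⟨p, hp, hvp⟩ | ⟨r, -, -, h3, -⟩
  · exact ⟨p, v, hp, hvp, h.notMem, .refl⟩
  · exact absurd hx (h3 x (by simp))

lemma exists_reachesAvoiding_of_mem_forb {v : V} (hv : v ∈ D.Forb X Y) :
    ∃ w ∈ D.Desc X, D.ReachesAvoiding X Y w ∧ ReflTransGen D.Edge w v := by
  obtain ⟨p, w, ⟨⟨x, hx, y, hy, -, -, hh, hl⟩, hX, hc⟩, hwp, hwX, hwv⟩ := hv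
  obtain ⟨r, rfl⟩ : ∃ r, p = x :: r := by
    cases p with
    | nil => simp at hh
    | cons b r => simp at hh; exact ⟨r, by rw [hh]⟩
  have hxw := hc.reaches w hwp
  rcases List.mem_cons.1 hwp with rfl | hwr
  · exact absurd hx hwX
  obtain ⟨s, t, rfl⟩ := List.append_of_mem hwr
  refine ⟨w, ⟨x, hx, hxw⟩, .of_append (s := x :: s) hc ⟨y, hy, hl⟩ fun z hz => hX z ?_, hwv⟩
  simp only [List.tail_cons, List.mem_append]
  exact .inr hz

/-- Nodes of `X` in the forbidden set would start a proper non-causal path inside the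
forbidden set that has no colliders, so no adjustment set could exist. -/
lemma SatisfiesAC.disjoint_forb {Z : Set V} (hAC : D.SatisfiesAC X Y Z) :
    ∀ x ∈ X, x ∉ D.Forb X Y := by
  intro x hx hxF
  obtain ⟨w, hwX, hw, hwx⟩ := exists_reachesAvoiding_of_mem_forb hxF
  have hwF := mem_forb_of_reachesAvoiding hw hwX
  let Good : V → List V → Prop := fun v r =>
      (v :: r).Nodup ∧ (v :: r).IsChain D.Adj ∧ (∀ u, ¬ D.IsColliderOn (v :: r) u) ∧
      (∀ t ∈ v :: r, t ∈ D.Forb X Y) ∧ (∃ y ∈ Y, (v :: r).getLast? = some y) ∧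
      (∀ t ∈ v :: r, t ∉ X) ∧
      ∀ t ∈ v :: r, D.ReachesAvoiding X Y t ∨ ReflTransGen D.Edge t v
  have base : ∀ v, ReflTransGen D.Edge w v → D.ReachesAvoiding X Y v → ∃ r, Good v r := by
    rintro v hv ⟨r, h1, h2, h3⟩
    refine ⟨r, h1.nodup, h1.isChain_adj, h1.not_isColliderOn,
      fun t ht => mem_forb_of_reaches hwF (hv.trans (h1.reaches t ht)), h2, h3,
      fun t ht => .inl ?_⟩
    obtain ⟨s, r', hs⟩ := List.append_of_mem ht
    rw [hs] at h1 h2 h3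
    exact .of_append h1 h2 fun z hz => h3 z (List.mem_append_right _ hz)
  have key : ∀ v, ReflTransGen D.Edge w v → ∃ r, Good v r := by
    intro v hv
    induction hv with
    | refl => exact base w .refl hw
    | @tail v v' hwv hvv' ih =>
      obtain ⟨r, h1, h2, h3, h4, h5, h6, h7⟩ := ih
      by_cases hG : D.ReachesAvoiding X Y v'
      · exact base v' (hwv.tail hvv') hG
      have hnot : v' ∉ v :: r := fun hm => (h7 v' hm).elim hG fun h =>
        D.acyclic v' (TransGen.tail' h hvv')
      have hnd : (v' :: v :: r).Nodup := List.nodup_cons.2 ⟨hnot, h1⟩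
      have hadj : (v' :: v :: r).IsChain D.Adj := List.isChain_cons_cons.2 ⟨.inr hvv', h2⟩
      have hcol := not_isColliderOn_cons hvv' h3
      have hF : ∀ t ∈ v' :: v :: r, t ∈ D.Forb X Y :=
        List.forall_mem_cons.2 ⟨mem_forb_of_reaches hwF (hwv.tail hvv'), h4⟩
      have hlast : ∃ y ∈ Y, (v' :: v :: r).getLast? = some y := by simpa using h5
      by_cases hX' : v' ∈ X
      · obtain ⟨y, hy, hl⟩ := hlast
        exfalso
        rcases hAC.2 (v' :: v :: r) ⟨⟨v', hX', y, hy, hnd, hadj, rfl, hl⟩, h6, fun hc =>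
          not_edge_of_edge hvv' (List.isChain_cons_cons.1 hc).1⟩ with
          ⟨u, ⟨⟨a, b, hi⟩, -⟩, hu⟩ | ⟨u, hu, -⟩
        · exact (Set.eq_empty_iff_forall_notMem.1 hAC.1 u)
            ⟨hu, hF u (hi.subset (by simp))⟩
        · exact hcol u hu
      · exact ⟨v :: r, hnd, hadj, hcol, hF, hlast, List.forall_mem_cons.2 ⟨hX', h6⟩,
          List.forall_mem_cons.2 ⟨.inr .refl, fun t ht => (h7 t ht).imp_right (.tail · hvv')⟩⟩
  obtain ⟨r, -, -, -, -, -, h, -⟩ := key x hwx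
  exact h x (by simp) hx

lemma isNonColliderOn_of_edge {l r : List V} {t u v : V} (hnd : (l ++ t :: u :: v :: r).Nodup)
    (h : ¬ (D.Edge t u ∧ D.Edge v u)) : D.IsNonColliderOn (l ++ t :: u :: v :: r) u := by
  refine ⟨⟨t, v, l, r, by simp⟩, ?_⟩
  rintro ⟨a, b, ⟨s, s', hs⟩, ha, hb⟩
  have h1 : (l ++ [t]) ++ u :: (v :: r) = (s ++ [a]) ++ u :: (b :: s') := by simpa using hs.symm
  have h2 : ((l ++ [t]) ++ u :: (v :: r)).Nodup := by simpa using hnd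
  have h3 := List.nodup_cons.1 (List.nodup_middle.1 h2)
  simp only [List.mem_append, not_or] at h3
  obtain ⟨h4, -, h5⟩ := (List.append_cons_inj_of_notMem
    (by simpa using h3.1.1) (by simpa using h3.1.2)).1 h1
  obtain ⟨-, h6⟩ := List.append_inj' h4 rfl
  simp only [List.cons.injEq, and_true] at h5 h6
  exact h ⟨h6 ▸ ha, h5.1 ▸ hb⟩

lemma blocks_of_edge_mem_forb {p : List V} {a : V} (hadj : p.IsChain D.Adj)
    (hh : p.head? = some a) (ha : a ∉ D.Forb X Y) (hS : ∀ v ∈ S, v ∉ D.Forb X Y)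
    {l r : List V} {u v : V} (hp : p = l ++ u :: v :: r) (huv : D.Edge v u)
    (hv : v ∈ D.Forb X Y) : D.Blocks S p := by
  have hu := mem_forb_of_reaches hv (.single huv)
  induction l using List.reverseRecOn generalizing u v r with
  | nil =>
    subst hp
    simp only [List.nil_append, List.head?_cons, Option.some.injEq] at hh
    exact absurd (hh ▸ hu) ha
  | append_singleton l t ih =>
    have hp' : p = l ++ t :: u :: (v :: r) := by simpa using hp
    have htu : D.Adj t u := by
      rw [hp'] at hadj
      exact (List.isChain_cons_cons.1 (List.isChain_append.1 hadj).2.1).1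
    rcases htu with htu | hut
    · refine .inr ⟨u, ⟨t, v, ⟨l, r, by simp [hp']⟩, htu, huv⟩, ?_⟩
      refine Set.eq_empty_iff_forall_notMem.2 ?_
      rintro s ⟨⟨_, rfl, hus⟩, hs⟩
      exact hS s hs (mem_forb_of_reaches hu hus)
    · exact ih hp' hut hu (mem_forb_of_reaches hu (.single hut))

/-- A path to `Y ∩ De(X)` that is not blocked must be causal if its first node and the
conditioning set avoid the forbidden set, and all other ancestors of `Y` outside the
conditioning set are in `De(X) \ X`. -/
lemma causal_of_not_blocks {p : List V} {a y : V} (hp : D.IsPathFrom p a y)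
    (hy : y ∈ Y) (hyD : y ∈ D.Desc X) (hyX : y ∉ X) (hay : a ≠ y)
    (ha : a ∉ D.Forb X Y) (hS : ∀ v ∈ S, v ∉ D.Forb X Y)
    (hanc : ∀ v, (∃ y ∈ Y, ReflTransGen D.Edge v y) → v ≠ a → v ∉ S → v ∈ D.Desc X ∧ v ∉ X)
    (hb : ¬ D.Blocks S p) :
    D.IsCausal p ∧ ∃ b, D.Edge a b ∧ D.ReachesAvoiding X Y b := by
  obtain ⟨hnd, hadj, hh, hl⟩ := hp
  have key : ∀ l v r, p = l ++ v :: r → v ≠ a → D.IsCausal (v :: r) →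
      D.ReachesAvoiding X Y v → v ∈ D.Desc X →
      D.IsCausal p ∧ ∃ b, D.Edge a b ∧ D.ReachesAvoiding X Y b := by
    intro l
    induction l using List.reverseRecOn with
    | nil =>
      rintro v r rfl hva
      simp only [List.nil_append, List.head?_cons, Option.some.injEq] at hh
      exact absurd hh hva
    | append_singleton l u ih =>
      intro v r hpe hva hc hG hvD
      have hpe' : p = l ++ u :: v :: r := by simpa using hpe
      have huv : D.Adj u v := by
        have hadj' : (l ++ u :: v :: r).IsChain D.Adj := hpe' ▸ hadj
        exact (List.isChain_cons_cons.1 (List.isChain_append.1 hadj').2.1).1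
      rcases huv with huv | hvu
      · have hc' : D.IsCausal (u :: v :: r) := List.isChain_cons_cons.2 ⟨huv, hc⟩
        rcases List.eq_nil_or_concat l with rfl | ⟨l', t, rfl⟩
        · subst hpe'
          simp only [List.nil_append, List.head?_cons, Option.some.injEq] at hh
          exact ⟨hc', v, hh ▸ huv, hG⟩
        · have hpe'' : p = l' ++ t :: u :: v :: r := by simpa using hpe'
          have hua : u ≠ a := by
            rintro rfl
            subst hpe''
            have h1 := List.nodup_cons.1 (List.nodup_middle.1
              (show ((l' ++ [t]) ++ u :: (v :: r)).Nodup by simpa using hnd))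
            refine h1.1 (List.mem_append_left _ ?_)
            rw [List.append_cons, List.head?_append_of_ne_nil _ (by simp)] at hh
            exact List.mem_of_head? hh
          have hnc : D.IsNonColliderOn p u := by
            rw [hpe'']
            exact isNonColliderOn_of_edge (hpe'' ▸ hnd) fun h => not_edge_of_edge huv h.2
          have huS : u ∉ S := fun h => hb (.inl ⟨u, hnc, h⟩)
          obtain ⟨y', hy', hvy'⟩ := hG.reaches
          obtain ⟨huD, huX⟩ := hanc u ⟨y', hy', .head huv hvy'⟩ hua huS
          exact ih u (v :: r) hpe' hua hc' (hG.cons huv huX) huD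
      · exact absurd (blocks_of_edge_mem_forb hadj hh ha hS hpe' hvu
          (mem_forb_of_reachesAvoiding hG hvD)) hb
  obtain ⟨l, hl'⟩ := List.getLast?_eq_some_iff.1 hl
  exact key l y [] hl' hay.symm (List.isChain_singleton y)
    ⟨[], List.isChain_singleton y, ⟨y, hy, rfl⟩, by simpa using hyX⟩ hyD

lemma triple_infix_reverse {p : List V} {a w b : V} (h : [a, w, b] <:+: p) :
    [b, w, a] <:+: p.reverse := by
  obtain ⟨l, r, rfl⟩ := h
  exact ⟨r.reverse, l.reverse, by simp⟩

lemma isColliderOn_reverse {p : List V} {w : V} :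
    D.IsColliderOn p.reverse w ↔ D.IsColliderOn p w := by
  have (q : List V) (h : D.IsColliderOn q w) : D.IsColliderOn q.reverse w := by
    obtain ⟨a, b, hi, ha, hb⟩ := h
    exact ⟨b, a, triple_infix_reverse hi, hb, ha⟩
  exact ⟨fun h => by simpa using this _ h, this p⟩

lemma blocks_of_reverse {p : List V} (h : D.Blocks S p.reverse) : D.Blocks S p := by
  simp only [Blocks, IsNonColliderOn, isColliderOn_reverse] at h ⊢
  rcases h with ⟨w, ⟨⟨a, b, hi⟩, hw⟩, hS⟩ | h
  · exact .inl ⟨w, ⟨⟨b, a, by simpa using triple_infix_reverse hi⟩, hw⟩, hS⟩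
  · exact .inr h

lemma IsPathFrom.reverse {p : List V} {x y : V} (h : D.IsPathFrom p x y) :
    D.IsPathFrom p.reverse y x := by
  obtain ⟨h1, h2, h3, h4⟩ := h
  refine ⟨List.nodup_reverse.2 h1, List.isChain_reverse.2 ?_, by simpa using h4, by simpa using h3⟩
  exact List.IsChain.imp (fun _ _ => Or.symm) h2

end

/-- Suppose `Z₀` satisfies the adjustment criterion relative to
`(X, Y)` in `D`, and let `Z = Z₀ ∪ (An(X ∪ Y, D) \ (De(X,D) ∪ Y))`,
`Z_D = Z ∩ De(X,D)`, `Z_N = Z \ De(X,D)`, `Y_D = Y ∩ De(X,D)`, `Y_N = Y \ De(X,D)`.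
Then (i) `(X ∪ Y_N ∪ Z) ∩ forb(X,Y,D) = ∅`; (ii) every non-causal path in `D` from a
node `a ∈ X ∪ Y_N ∪ Z` to a node of `Y_D` is blocked by `(X ∪ Y_N ∪ Z_N) \ {a}`; and
(iii) `Y_D` and `Z_D` are d-separated given `Y_N ∪ X ∪ Z_N` in `D`. -/
theorem enlarged_set_separation_properties
    (D : DAG V) (X Y Z₀ : Set V)
    (hXY : Disjoint X Y) (hXZ : Disjoint X Z₀) (hYZ : Disjoint Y Z₀)
    (hX : X.Nonempty) (hY : Y.Nonempty)
    (hAC : D.SatisfiesAC X Y Z₀) :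
    (X ∪ (Y \ D.Desc X) ∪ (Z₀ ∪ (D.Anc (X ∪ Y) \ (D.Desc X ∪ Y)))) ∩
        D.Forb X Y = ∅ ∧
    (∀ a ∈ X ∪ (Y \ D.Desc X) ∪ (Z₀ ∪ (D.Anc (X ∪ Y) \ (D.Desc X ∪ Y))),
      ∀ yd ∈ Y ∩ D.Desc X, ∀ p, D.IsPathFrom p a yd → ¬ D.IsCausal p →
        D.Blocks ((X ∪ (Y \ D.Desc X) ∪
          ((Z₀ ∪ (D.Anc (X ∪ Y) \ (D.Desc X ∪ Y))) \ D.Desc X)) \ {a}) p) ∧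
    D.DSep (Y ∩ D.Desc X)
      ((Z₀ ∪ (D.Anc (X ∪ Y) \ (D.Desc X ∪ Y))) ∩ D.Desc X)
      ((Y \ D.Desc X) ∪ X ∪
        ((Z₀ ∪ (D.Anc (X ∪ Y) \ (D.Desc X ∪ Y))) \ D.Desc X)) := by
  set Z := Z₀ ∪ (D.Anc (X ∪ Y) \ (D.Desc X ∪ Y)) with hZ
  have hXF := hAC.disjoint_forb
  have hFD : ∀ v ∈ D.Forb X Y, v ∈ D.Desc X := fun v hv => by
    obtain ⟨w, hw, -, hwv⟩ := exists_reachesAvoiding_of_mem_forb hv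
    exact mem_desc_of_reaches hw hwv
  have hXD : ∀ v ∈ X, v ∈ D.Desc X := fun v hv => ⟨v, hv, .refl⟩
  have hZF : ∀ v ∈ Z, v ∉ D.Forb X Y := by
    rintro v (hv | hv) hF
    · exact Set.eq_empty_iff_forall_notMem.1 hAC.1 v ⟨hv, hF⟩
    · exact hv.2 (.inl (hFD v hF))
  have hAF : ∀ v ∈ X ∪ (Y \ D.Desc X) ∪ Z, v ∉ D.Forb X Y := by
    rintro v ((hv | hv) | hv)
    · exact hXF v hv
    · exact fun hF => hv.2 (hFD v hF)
    · exact hZF v hv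
  have hZY : ∀ v ∈ Z, v ∉ Y := by
    rintro v (hv | hv) hY
    · exact Set.disjoint_left.1 hYZ hY hv
    · exact hv.2 (.inr hY)
  have hZX : ∀ v ∈ Z, v ∉ X := by
    rintro v (hv | hv) hX
    · exact Set.disjoint_left.1 hXZ hX hv
    · exact hv.2 (.inl (hXD v hX))
  have hanc : ∀ v, (∃ y ∈ Y, ReflTransGen D.Edge v y) →
      v ∉ X ∪ (Y \ D.Desc X) ∪ (Z \ D.Desc X) → v ∈ D.Desc X ∧ v ∉ X := by
    rintro v ⟨y, hy, hvy⟩ hv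
    simp only [Set.mem_union, Set.mem_sdiff, not_or, not_and, not_not] at hv
    refine ⟨?_, hv.1.1⟩
    by_contra hD
    exact hD (hv.2 (.inr ⟨⟨y, .inr hy, hvy⟩, fun h => h.elim hD fun h => hD (hv.1.2 h)⟩))
  have hne : ∀ a ∈ X ∪ (Y \ D.Desc X) ∪ Z, ∀ y ∈ Y ∩ D.Desc X, a ≠ y := by
    rintro a ((ha | ha) | ha) y hy rfl
    · exact Set.disjoint_left.1 hXY ha hy.1
    · exact ha.2 hy.2
    · exact hZY a ha hy.1
  have key : ∀ a ∈ X ∪ (Y \ D.Desc X) ∪ Z, ∀ y ∈ Y ∩ D.Desc X, ∀ p, D.IsPathFrom p a y →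
      ¬ D.Blocks ((X ∪ (Y \ D.Desc X) ∪ (Z \ D.Desc X)) \ {a}) p →
      D.IsCausal p ∧ ∃ b, D.Edge a b ∧ D.ReachesAvoiding X Y b := by
    intro a ha y hy p hp hb
    refine causal_of_not_blocks hp hy.1 hy.2 (Set.disjoint_right.1 hXY hy.1) (hne a ha y hy)
      (hAF a ha) ?_ (fun v hv hva hvS => hanc v hv fun h =>
        hvS (Set.mem_sdiff_singleton.2 ⟨h, hva⟩)) hb
    exact fun v hv => hAF v (Set.union_subset_union_right _ Set.sdiff_subset hv.1)
  refine ⟨?_, fun a ha y hy p hp hnc => ?_, fun y hy z hz p hp => blocks_of_reverse ?_⟩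
  · exact Set.eq_empty_iff_forall_notMem.2 fun v hv => hAF v hv.1 hv.2
  · by_contra hb
    exact hnc (key a ha y hy p hp hb).1
  · have hzS : z ∉ X ∪ (Y \ D.Desc X) ∪ (Z \ D.Desc X) := by
      rintro ((h | h) | h)
      exacts [hZX z hz.1 h, h.2 hz.2, h.2 hz.2]
    rw [Set.union_comm (Y \ D.Desc X) X, ← Set.sdiff_singleton_eq_self hzS]
    by_contra hb
    obtain ⟨-, b, hzb, hG⟩ := key z (.inr hz.1) y hy _ hp.reverse hb
    exact hZF z hz.1 (mem_forb_of_reachesAvoiding (hG.cons hzb (hZX z hz.1)) hz.2)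

end DAG
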